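/- Let λ > 0 and let (β_n)_{n≥0} be a sequence with 0 < β_n ≤ 1 for all n. For n ≥ 0 and t ≥ 0 define q(n,t) = (−1)^n ∑_{k=n}^∞ (−λ)^k ∑_{(k_0,…,k_n) ∈ Ω^k_n} t^{∑_{j=0}^n k_j β_j} / Γ(1 + ∑_{j=0}^n k_j β_j), and set q(−1,t) = 0 with the convention that the term for n−1 = −1 vanishes. Then for every n ≥ 0 and every t ≥ 0, q(n,t) = [n=0] − λ · (I^{β_n}_t q(n,·))(t) + λ · (I^{β_{n−1}}_t q(n−1,·))(t), where [n=0] equals 1 if n = 0 and 0 otherwise. -/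

import Mathlib

open scoped BigOperators

/-- Riemann–Liouville fractional integral of order `α`. -/
noncomputable def rlInt (α : ℝ) (f : ℝ → ℝ) (t : ℝ) : ℝ :=
  (1 / Real.Gamma α) * ∫ s in (0:ℝ)..t, (t - s) ^ (α - 1) * f s

/-- `Theta n k` is the set of tuples `(k_0, …, k_n)` of nonnegative integers with
`k_0 + ⋯ + k_n = k` and `k_j ≥ 1` for `1 ≤ j ≤ n`. -/
def Theta (n k : ℕ) : Finset (Fin (n + 1) → ℕ) :=
  (Finset.Nat.antidiagonalTuple (n + 1) k).filter
    (fun κ => ∀ j : Fin (n + 1), 1 ≤ j.val → 1 ≤ κ j)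

/-- The state probabilities of SDTFPP-I (note that `Theta n k = ∅` for `k < n`,
so the series over all `k : ℕ` agrees with the series starting at `k = n`). -/
noncomputable def pI (lam : ℝ) (α : ℕ → ℝ) (n : ℕ) (t : ℝ) : ℝ :=
  (-1 : ℝ) ^ n * ∑' k : ℕ, (-lam) ^ k *
    ∑ κ ∈ Theta n k,
      t ^ (∑ j, (κ j : ℝ) * α j.val) / Real.Gamma (1 + ∑ j, (κ j : ℝ) * α j.val)
/-- `Omega n k` is the set of tuples `(k_0, …, k_n)` of nonnegative integers with
`k_0 + ⋯ + k_n = k` and `k_j ≥ 1` for `0 ≤ j ≤ n - 1` (`k_n` may be `0`). -/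
def Omega (n k : ℕ) : Finset (Fin (n + 1) → ℕ) :=
  (Finset.Nat.antidiagonalTuple (n + 1) k).filter
    (fun κ => ∀ j : Fin (n + 1), j.val < n → 1 ≤ κ j)

/-- The state probabilities of SDTFPP-II (note that `Omega n k = ∅` for `k < n`,
so the series over all `k : ℕ` agrees with the series starting at `k = n`). -/
noncomputable def qII (lam : ℝ) (β : ℕ → ℝ) (n : ℕ) (t : ℝ) : ℝ :=
  (-1 : ℝ) ^ n * ∑' k : ℕ, (-lam) ^ k *
    ∑ κ ∈ Omega n k,
      t ^ (∑ j, (κ j : ℝ) * β j.val) / Real.Gamma (1 + ∑ j, (κ j : ℝ) * β j.val)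

open MeasureTheory Set

/-- The normalized power `u ^ s / Γ(1 + s)`. -/
noncomputable def rlPow (s u : ℝ) : ℝ := u ^ s / Real.Gamma (1 + s)

lemma rlPow_nonneg {s u : ℝ} (hs : 0 ≤ s) (hu : 0 ≤ u) : 0 ≤ rlPow s u :=
  div_nonneg (Real.rpow_nonneg hu s) (Real.Gamma_pos_of_pos (by linarith)).le

lemma intervalIntegrable_rl_kernel {α : ℝ} (hα : 0 < α) (t : ℝ) :
    IntervalIntegrable (fun u : ℝ => (t - u) ^ (α - 1)) volume 0 t := by
  have h := (intervalIntegral.intervalIntegrable_rpow' (a := t) (b := 0)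
    (r := α - 1) (by linarith)).comp_sub_left t
  simpa using h

lemma continuous_rlPow {s : ℝ} (hs : 0 ≤ s) : Continuous (rlPow s) :=
  (Real.continuous_rpow_const hs).div_const _

/-- Fractional integration shifts the exponent of a normalized power. -/
lemma rlInt_rlPow {α s t : ℝ} (hα : 0 < α) (hs : 0 ≤ s) (ht : 0 ≤ t) :
    rlInt α (rlPow s) t = rlPow (s + α) t := by
  rcases ht.eq_or_lt with rfl | ht
  · simp [rlInt, rlPow, Real.zero_rpow (by linarith : s + α ≠ 0)]
  have hint : ∫ u in (0:ℝ)..t, (t - u) ^ (α - 1) * u ^ s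
      = t ^ (s + α) * (Real.Gamma (1 + s) * Real.Gamma α / Real.Gamma (1 + (s + α))) := by
    have h := Complex.betaIntegral_scaled ((1 + s : ℝ) : ℂ) (α : ℂ) ht
    rw [Complex.betaIntegral_eq_Gamma_mul_div _ _ (by rw [Complex.ofReal_re]; linarith) (by simpa),
      ← Complex.ofReal_add, Complex.Gamma_ofReal, Complex.Gamma_ofReal, Complex.Gamma_ofReal] at h
    have h2 : ∫ x in (0:ℝ)..t, (x : ℂ) ^ (((1 + s : ℝ) : ℂ) - 1) * ((t : ℂ) - x) ^ ((α : ℂ) - 1)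
        = ∫ u in (0:ℝ)..t, (((t - u) ^ (α - 1) * u ^ s : ℝ) : ℂ) := by
      refine intervalIntegral.integral_congr fun u hu => ?_
      rw [uIcc_of_le ht.le] at hu
      have h3 : (((1 + s : ℝ) : ℂ) - 1) = ((s : ℝ) : ℂ) := by push_cast; ring
      have h4 : ((α : ℂ) - 1) = ((α - 1 : ℝ) : ℂ) := by push_cast; ring
      simp only [h3, h4]
      rw [← Complex.ofReal_sub, ← Complex.ofReal_cpow hu.1,
        ← Complex.ofReal_cpow (sub_nonneg.2 hu.2), ← Complex.ofReal_mul, mul_comm]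
    have h5 : (((1 + s + α : ℝ) : ℂ) - 1) = ((s + α : ℝ) : ℂ) := by push_cast; ring
    rw [h2, intervalIntegral.integral_ofReal, h5, ← Complex.ofReal_cpow ht.le, add_assoc] at h
    exact_mod_cast h
  have hG : Real.Gamma (1 + s) ≠ 0 := (Real.Gamma_pos_of_pos (by linarith)).ne'
  have hG' : Real.Gamma α ≠ 0 := (Real.Gamma_pos_of_pos hα).ne'
  simp only [rlInt, rlPow, ← mul_div_assoc]
  rw [intervalIntegral.integral_div, hint]
  field_simp

lemma rpow_mul_exp_neg_le_Gamma {A s : ℝ} (hA : 0 ≤ A) (hs : 0 ≤ s) :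
    A ^ s * Real.exp (-A) ≤ Real.Gamma (1 + s) := by
  have hint := Real.GammaIntegral_convergent (s := 1 + s) (by linarith)
  rw [Real.Gamma_eq_integral (by linarith), ← integral_exp_neg_Ioi, ← integral_const_mul]
  simp only [add_sub_cancel_left] at hint ⊢
  have hsub : Ioi A ⊆ Ioi (0:ℝ) := Ioi_subset_Ioi hA
  refine le_trans (setIntegral_mono_on ((integrableOn_exp_neg_Ioi A).const_mul _)
    (hint.mono_set hsub) measurableSet_Ioi fun x hx => ?_)
    (setIntegral_mono_set hint ?_ hsub.eventuallyLE)
  · rw [mul_comm]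
    exact mul_le_mul_of_nonneg_left (Real.rpow_le_rpow hA (mem_Ioi.1 hx).le hs) (Real.exp_pos _).le
  · exact ae_restrict_of_forall_mem measurableSet_Ioi fun x hx =>
      mul_nonneg (Real.exp_pos _).le (Real.rpow_nonneg (mem_Ioi.1 hx).le _)

lemma rlPow_le {r s t : ℝ} (hr : 0 < r) (hs : 0 ≤ s) (ht : 0 ≤ t) :
    rlPow s t ≤ Real.exp (t / r) * r ^ s := by
  have h := rpow_mul_exp_neg_le_Gamma (div_nonneg ht hr.le) hs
  rw [rlPow, div_le_iff₀ (Real.Gamma_pos_of_pos (by linarith))]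
  calc t ^ s = Real.exp (t / r) * r ^ s * ((t / r) ^ s * Real.exp (-(t / r))) := by
        have hrs : r ^ s ≠ 0 := (Real.rpow_pos_of_pos hr s).ne'
        rw [Real.div_rpow ht hr.le, Real.exp_neg]
        field_simp
    _ ≤ _ := mul_le_mul_of_nonneg_left h (by positivity)

/-- The exponent attached to a tuple `κ`. -/
noncomputable def tupleExp (β : ℕ → ℝ) {n : ℕ} (κ : Fin (n + 1) → ℕ) : ℝ :=
  ∑ j, (κ j : ℝ) * β j.val

lemma tupleExp_nonneg {β : ℕ → ℝ} (hβ : ∀ n, 0 < β n) {n : ℕ} (κ : Fin (n + 1) → ℕ) :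
    0 ≤ tupleExp β κ :=
  Finset.sum_nonneg fun _ _ => mul_nonneg (Nat.cast_nonneg _) (hβ _).le

lemma mem_Omega {n k : ℕ} {κ : Fin (n + 1) → ℕ} :
    κ ∈ Omega n k ↔ ∑ j, κ j = k ∧ ∀ j : Fin (n + 1), j.val < n → 1 ≤ κ j := by
  simp [Omega, Finset.Nat.mem_antidiagonalTuple]

lemma tupleExp_add_single (β : ℕ → ℝ) {n : ℕ} (κ : Fin (n + 1) → ℕ) :
    tupleExp β (κ + Pi.single (Fin.last n) 1) = tupleExp β κ + β n := by
  simp [tupleExp, add_mul, Finset.sum_add_distrib, Pi.single_apply]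

lemma filter_Omega_succ_last_ne_zero (n k : ℕ) :
    (Omega n (k + 1)).filter (fun κ => κ (Fin.last n) ≠ 0)
      = (Omega n k).map (addRightEmbedding (Pi.single (Fin.last n) 1)) := by
  have key : ∀ κ : Fin (n + 1) → ℕ, κ + Pi.single (Fin.last n) 1 ∈ Omega n (k + 1) ↔
      κ ∈ Omega n k := by
    intro κ
    simp only [mem_Omega, Pi.add_apply, Finset.sum_add_distrib, Finset.sum_pi_single',
      Finset.mem_univ, if_true, add_left_inj]
    refine and_congr (by simp) (forall₂_congr fun j hj => ?_)
    rw [Pi.single_eq_of_ne (fun h => by simp [h] at hj), add_zero]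
  ext κ
  simp only [Finset.mem_filter, Finset.mem_map, addRightEmbedding_apply]
  constructor
  · rintro ⟨h, h0⟩
    have hle : Pi.single (Fin.last n) 1 ≤ κ := by
      intro j
      rcases eq_or_ne j (Fin.last n) with rfl | hj
      · simpa using Nat.one_le_iff_ne_zero.2 h0
      · simp [Pi.single_eq_of_ne hj]
    have hκ := tsub_add_cancel_of_le hle
    exact ⟨_, (key _).1 (hκ.symm ▸ h), hκ⟩
  · rintro ⟨κ', h, rfl⟩
    exact ⟨(key _).2 h, by simp⟩

lemma sum_Omega_succ_last_ne_zero (β : ℕ → ℝ) (F : ℝ → ℝ) (n k : ℕ) :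
    ∑ κ ∈ (Omega n (k + 1)).filter (fun κ => κ (Fin.last n) ≠ 0), F (tupleExp β κ)
      = ∑ κ ∈ Omega n k, F (tupleExp β κ + β n) := by
  simp [filter_Omega_succ_last_ne_zero, tupleExp_add_single]

lemma sum_Omega_last_eq_zero (β : ℕ → ℝ) (F : ℝ → ℝ) (m k : ℕ) :
    ∑ κ ∈ (Omega (m + 1) k).filter (fun κ => κ (Fin.last (m + 1)) = 0), F (tupleExp β κ)
      = ∑ κ ∈ (Omega m k).filter (fun κ => κ (Fin.last m) ≠ 0), F (tupleExp β κ) := by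
  refine Finset.sum_nbij' (fun κ => Fin.init κ) (fun κ => Fin.snoc (α := fun _ => ℕ) κ 0)
    ?_ ?_ ?_ ?_ ?_
  · intro κ h
    simp only [Finset.mem_filter, mem_Omega] at h ⊢
    obtain ⟨⟨h1, h2⟩, h3⟩ := h
    rw [Fin.sum_univ_castSucc, h3, add_zero] at h1
    refine ⟨⟨h1, fun j hj => h2 j.castSucc (by simp; omega)⟩, ?_⟩
    exact Nat.one_le_iff_ne_zero.1 (h2 (Fin.last m).castSucc (by simp))
  · intro κ h
    simp only [Finset.mem_filter, mem_Omega] at h ⊢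
    obtain ⟨⟨h1, h2⟩, h3⟩ := h
    refine ⟨⟨by simpa [Fin.sum_univ_castSucc (n := m + 1)] using h1, fun j => ?_⟩, by simp⟩
    refine Fin.lastCases (fun hj => by simp at hj) (fun i hi => ?_) j
    rw [Fin.snoc_castSucc]
    rcases eq_or_ne i (Fin.last m) with rfl | hne
    · exact Nat.one_le_iff_ne_zero.2 h3
    · exact h2 i (Fin.val_lt_last hne)
  · intro κ h
    rw [Finset.mem_filter] at h
    rw [← h.2, Fin.snoc_init_self]
  · intro κ _
    simp
  · intro κ h
    rw [Finset.mem_filter] at h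
    congr 1
    rw [tupleExp, Fin.sum_univ_castSucc, h.2]
    simp [tupleExp, Fin.init]

lemma sum_Omega_succ_succ (β : ℕ → ℝ) (F : ℝ → ℝ) (m k : ℕ) :
    ∑ κ ∈ Omega (m + 1) (k + 1), F (tupleExp β κ)
      = ∑ κ ∈ Omega (m + 1) k, F (tupleExp β κ + β (m + 1))
        + ∑ κ ∈ Omega m k, F (tupleExp β κ + β m) := by
  rw [← Finset.sum_filter_not_add_sum_filter _ (fun κ => κ (Fin.last (m + 1)) = 0),
    sum_Omega_last_eq_zero, sum_Omega_succ_last_ne_zero, sum_Omega_succ_last_ne_zero]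

lemma sum_Omega_zero_succ (β : ℕ → ℝ) (F : ℝ → ℝ) (k : ℕ) :
    ∑ κ ∈ Omega 0 (k + 1), F (tupleExp β κ) = ∑ κ ∈ Omega 0 k, F (tupleExp β κ + β 0) := by
  rw [← sum_Omega_succ_last_ne_zero, Finset.filter_true_of_mem]
  intro κ h
  have h1 : κ (Fin.last 0) = k + 1 := (Fin.sum_univ_one κ).symm.trans (mem_Omega.1 h).1
  omega

lemma sum_Omega_zero (β : ℕ → ℝ) (F : ℝ → ℝ) (n : ℕ) :
    ∑ κ ∈ Omega n 0, F (tupleExp β κ) = if n = 0 then F 0 else 0 := by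
  split_ifs with h
  · subst h
    rw [show Omega 0 0 = {0} by
      ext κ; simp [mem_Omega, funext_iff]]
    simp [tupleExp]
  · refine Finset.sum_eq_zero fun κ hκ => absurd hκ fun hκ => ?_
    obtain ⟨h1, h2⟩ := mem_Omega.1 hκ
    have h3 := h2 0 (by simpa using Nat.pos_of_ne_zero h)
    have h4 := (Finset.sum_eq_zero_iff.1 h1) 0 (Finset.mem_univ _)
    omega

lemma sum_Omega_rpow_le {β : ℕ → ℝ} {r ε : ℝ} (hr : 0 < r) (n : ℕ)
    (hε : ∀ j ≤ n, r ^ β j ≤ ε) (k : ℕ) :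
    ∑ κ ∈ Omega n k, r ^ tupleExp β κ ≤ (2 * ε) ^ k := by
  have hε0 : 0 ≤ ε := (Real.rpow_nonneg hr.le _).trans (hε 0 (Nat.zero_le n))
  have step : ∀ m ≤ n, ∀ k, ∑ κ ∈ Omega m k, r ^ tupleExp β κ ≤ (2 * ε) ^ k →
      ∑ κ ∈ Omega m k, r ^ (tupleExp β κ + β m) ≤ (2 * ε) ^ k * ε := by
    intro m hm k h
    simp only [Real.rpow_add hr, ← Finset.sum_mul]
    exact mul_le_mul h (hε m hm) (Real.rpow_nonneg hr.le _) (by positivity)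
  suffices H : ∀ k, ∀ m ≤ n, ∑ κ ∈ Omega m k, r ^ tupleExp β κ ≤ (2 * ε) ^ k from H k n le_rfl
  intro k
  induction k with
  | zero =>
    intro m _
    rw [sum_Omega_zero β (fun s => r ^ s)]
    split_ifs <;> simp
  | succ k ih =>
    intro m hm
    have h1 := step m hm k (ih m hm)
    have h0 : 0 ≤ (2 * ε) ^ k * ε := by positivity
    rw [pow_succ]
    cases m with
    | zero =>
      rw [sum_Omega_zero_succ β (fun s => r ^ s)]
      linarith
    | succ m =>
      rw [sum_Omega_succ_succ β (fun s => r ^ s)]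
      have h2 := step m (by omega) k (ih m (by omega))
      linarith

/-- The coefficient of `(-λ) ^ k` in the series of `(-1) ^ n * qII λ β n`. -/
noncomputable def qCoeff (β : ℕ → ℝ) (n k : ℕ) (u : ℝ) : ℝ :=
  ∑ κ ∈ Omega n k, rlPow (tupleExp β κ) u

lemma qCoeff_nonneg {β : ℕ → ℝ} (hβ : ∀ n, 0 < β n)
    (n k : ℕ) {u : ℝ} (hu : 0 ≤ u) : 0 ≤ qCoeff β n k u :=
  Finset.sum_nonneg fun κ _ => rlPow_nonneg (tupleExp_nonneg hβ κ) hu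

lemma continuous_qCoeff {β : ℕ → ℝ} (hβ : ∀ n, 0 < β n)
    (n k : ℕ) : Continuous (qCoeff β n k) :=
  continuous_finsetSum _ fun κ _ => continuous_rlPow (tupleExp_nonneg hβ κ)

lemma rlInt_qCoeff {β : ℕ → ℝ} (hβ : ∀ n, 0 < β n)
    {α : ℝ} (hα : 0 < α) (n k : ℕ) {t : ℝ} (ht : 0 ≤ t) :
    rlInt α (qCoeff β n k) t = ∑ κ ∈ Omega n k, rlPow (tupleExp β κ + α) t := by
  simp only [← fun κ : Fin (n + 1) → ℕ => rlInt_rlPow hα (tupleExp_nonneg hβ κ) ht]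
  simp only [rlInt, qCoeff, Finset.mul_sum]
  rw [intervalIntegral.integral_finsetSum fun κ _ =>
    (intervalIntegrable_rl_kernel hα t).mul_continuousOn
      (continuous_rlPow (tupleExp_nonneg hβ κ)).continuousOn, Finset.mul_sum]

lemma qCoeff_succ {β : ℕ → ℝ} (hβ : ∀ n, 0 < β n)
    (n k : ℕ) {t : ℝ} (ht : 0 ≤ t) :
    qCoeff β n (k + 1) t = rlInt (β n) (qCoeff β n k) t
      + if n = 0 then 0 else rlInt (β (n - 1)) (qCoeff β (n - 1) k) t := by
  rw [rlInt_qCoeff hβ (hβ n) n k ht, rlInt_qCoeff hβ (hβ (n - 1)) (n - 1) k ht]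
  cases n with
  | zero => simpa [qCoeff] using sum_Omega_zero_succ β (fun s => rlPow s t) k
  | succ m => simpa [qCoeff] using sum_Omega_succ_succ β (fun s => rlPow s t) m k

lemma rlInt_qCoeff_nonneg {β : ℕ → ℝ} (hβ : ∀ n, 0 < β n)
    {α : ℝ} (hα : 0 < α) (n k : ℕ) {t : ℝ} (ht : 0 ≤ t) :
    0 ≤ rlInt α (qCoeff β n k) t := by
  rw [rlInt_qCoeff hβ hα n k ht]
  exact Finset.sum_nonneg fun κ _ =>
    rlPow_nonneg (add_nonneg (tupleExp_nonneg hβ κ) hα.le) ht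

lemma summable_qCoeff {β : ℕ → ℝ} (hβ : ∀ n, 0 < β n)
    {lam : ℝ} (hlam : 0 < lam) (n : ℕ) {t : ℝ} (ht : 0 ≤ t) :
    Summable fun k => lam ^ k * qCoeff β n k t := by
  obtain ⟨r, hr, hrβ⟩ : ∃ r : ℝ, 0 < r ∧ ∀ j ≤ n, r ^ β j ≤ 1 / (4 * lam) := by
    have h : ∀ᶠ r : ℝ in nhdsWithin 0 (Ioi 0), ∀ j ∈ Finset.range (n + 1),
        r ^ β j ≤ 1 / (4 * lam) := by
      rw [Filter.eventually_all_finset]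
      intro j _
      have h1 : Filter.Tendsto (fun r : ℝ => r ^ β j) (nhdsWithin 0 (Ioi 0)) (nhds 0) := by
        have h2 := (Real.continuous_rpow_const (hβ j).le).tendsto 0
        rw [Real.zero_rpow (hβ j).ne'] at h2
        exact h2.mono_left nhdsWithin_le_nhds
      exact h1.eventually_le_const (by positivity)
    obtain ⟨r, h1, h2⟩ := (h.and self_mem_nhdsWithin).exists
    exact ⟨r, h2, fun j hj => h1 j (Finset.mem_range.2 (by omega))⟩
  refine Summable.of_nonneg_of_le
    (fun k => mul_nonneg (by positivity) (qCoeff_nonneg hβ n k ht)) (fun k => ?_)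
    (summable_geometric_two.mul_left (Real.exp (t / r)))
  calc lam ^ k * qCoeff β n k t
      ≤ lam ^ k * (Real.exp (t / r) * (2 * (1 / (4 * lam))) ^ k) := by
        refine mul_le_mul_of_nonneg_left ?_ (by positivity)
        refine le_trans (Finset.sum_le_sum fun κ _ =>
          rlPow_le hr (tupleExp_nonneg hβ κ) ht) ?_
        rw [← Finset.mul_sum]
        exact mul_le_mul_of_nonneg_left (sum_Omega_rpow_le hr n hrβ k) (Real.exp_pos _).le
    _ = Real.exp (t / r) * (1 / 2) ^ k := by
        rw [mul_left_comm, ← mul_pow]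
        congr 2
        field_simp
        norm_num

lemma summable_rlInt_qCoeff {β : ℕ → ℝ} (hβ : ∀ n, 0 < β n)
    {lam : ℝ} (hlam : 0 < lam) (n : ℕ) {t : ℝ} (ht : 0 ≤ t) :
    Summable fun k => lam ^ k * rlInt (β n) (qCoeff β n k) t := by
  refine Summable.of_nonneg_of_le
    (fun k => mul_nonneg (by positivity) (rlInt_qCoeff_nonneg hβ (hβ n) n k ht)) (fun k => ?_)
    (((summable_nat_add_iff 1).2 (summable_qCoeff hβ hlam n ht)).mul_left lam⁻¹)
  rw [pow_succ, mul_comm (lam ^ k) lam, mul_assoc, inv_mul_cancel_left₀ hlam.ne',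
    qCoeff_succ hβ n k ht]
  refine mul_le_mul_of_nonneg_left (le_add_of_nonneg_right ?_) (by positivity)
  split_ifs
  · exact le_rfl
  · exact rlInt_qCoeff_nonneg hβ (hβ _) _ k ht

/-- The fractional integral of order `β n` may be computed termwise. -/
lemma hasSum_rlInt_qCoeff {β : ℕ → ℝ} (hβ : ∀ n, 0 < β n)
    {lam : ℝ} (hlam : 0 < lam) (n : ℕ) {t : ℝ} (ht : 0 ≤ t) :
    HasSum (fun k => (-lam) ^ k * rlInt (β n) (qCoeff β n k) t)
      (rlInt (β n) (fun u => ∑' k, (-lam) ^ k * qCoeff β n k u) t) := by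
  have hΓ : Real.Gamma (β n) ≠ 0 := (Real.Gamma_pos_of_pos (hβ n)).ne'
  have hint : ∀ k, IntegrableOn
      (fun u => (-lam) ^ k * ((t - u) ^ (β n - 1) * qCoeff β n k u)) (Ioc 0 t) := fun k =>
    ((intervalIntegrable_iff_integrableOn_Ioc_of_le ht).1
      ((intervalIntegrable_rl_kernel (hβ n) t).mul_continuousOn
        (continuous_qCoeff hβ n k).continuousOn)).const_mul _
  have hnorm : ∀ k, ∫ u in Ioc 0 t, ‖(-lam) ^ k * ((t - u) ^ (β n - 1) * qCoeff β n k u)‖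
      = Real.Gamma (β n) * (lam ^ k * rlInt (β n) (qCoeff β n k) t) := by
    intro k
    have h : ∫ u in Ioc 0 t, ‖(-lam) ^ k * ((t - u) ^ (β n - 1) * qCoeff β n k u)‖
        = ∫ u in Ioc 0 t, lam ^ k * ((t - u) ^ (β n - 1) * qCoeff β n k u) := by
      refine setIntegral_congr_fun measurableSet_Ioc fun u hu => ?_
      simp only [norm_mul, norm_pow, norm_neg, Real.norm_eq_abs, abs_of_pos hlam,
        abs_of_nonneg (Real.rpow_nonneg (sub_nonneg.2 hu.2) _),
        abs_of_nonneg (qCoeff_nonneg hβ n k hu.1.le)]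
    rw [h, integral_const_mul, rlInt, intervalIntegral.integral_of_le ht]
    field_simp
  have hsum := hasSum_integral_of_summable_integral_norm hint (by
    simp only [hnorm]
    exact (summable_rlInt_qCoeff hβ hlam n ht).mul_left _)
  have hterm : ∀ k, (-lam) ^ k * rlInt (β n) (qCoeff β n k) t = 1 / Real.Gamma (β n) *
      ∫ u in Ioc 0 t, (-lam) ^ k * ((t - u) ^ (β n - 1) * qCoeff β n k u) := fun k => by
    rw [integral_const_mul, rlInt, intervalIntegral.integral_of_le ht, mul_left_comm]
  have htsum : ∀ u, (t - u) ^ (β n - 1) * ∑' k, (-lam) ^ k * qCoeff β n k u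
      = ∑' k, (-lam) ^ k * ((t - u) ^ (β n - 1) * qCoeff β n k u) := fun u => by
    rw [← tsum_mul_left]
    exact tsum_congr fun k => mul_left_comm _ _ _
  simp only [hterm]
  simp only [rlInt, intervalIntegral.integral_of_le ht, htsum]
  exact hsum.mul_left _

lemma qII_eq (lam : ℝ) (β : ℕ → ℝ) (n : ℕ) :
    qII lam β n = fun u => (-1) ^ n * ∑' k, (-lam) ^ k * qCoeff β n k u := rfl

lemma rlInt_const_mul (α c : ℝ) (f : ℝ → ℝ) (t : ℝ) :
    rlInt α (fun u => c * f u) t = c * rlInt α f t := by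
  simp only [rlInt, mul_left_comm _ c, intervalIntegral.integral_const_mul]

/-- The SDTFPP-II state probabilities solve the governing integral equation. -/
theorem sdtfppII_integral_equation (lam : ℝ) (hlam : 0 < lam)
    (β : ℕ → ℝ) (hβ : ∀ n, 0 < β n ∧ β n ≤ 1)
    (n : ℕ) (t : ℝ) (ht : 0 ≤ t) :
    qII lam β n t
      = (if n = 0 then (1:ℝ) else 0)
        - lam * rlInt (β n) (fun u => qII lam β n u) t
        + lam * rlInt (β (n - 1)) (fun u => if n = 0 then (0:ℝ) else qII lam β (n - 1) u) t := by
  have hpos : ∀ n, 0 < β n := fun n => (hβ n).1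
  have hzero : qCoeff β n 0 t = if n = 0 then 1 else 0 := by
    simpa [qCoeff, rlPow] using sum_Omega_zero β (fun s => rlPow s t) n
  have hsum : Summable fun k => (-lam) ^ k * qCoeff β n k t :=
    Summable.of_norm <| (summable_qCoeff hpos hlam n ht).congr fun k => by
      simp [abs_of_pos hlam, abs_of_nonneg (qCoeff_nonneg hpos n k ht)]
  have hself := hasSum_rlInt_qCoeff hpos hlam n ht
  simp only [qII_eq, rlInt_const_mul]
  rw [hsum.tsum_eq_zero_add, hzero]
  simp only [qCoeff_succ hpos n _ ht]
  cases n with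
  | zero =>
    simp only [if_true, add_zero, pow_succ', mul_assoc, tsum_mul_left, hself.tsum_eq]
    simp [rlInt, sub_eq_add_neg]
  | succ m =>
    have hprev := hasSum_rlInt_qCoeff hpos hlam m ht
    simp only [Nat.add_one_ne_zero, if_false, Nat.add_sub_cancel, rlInt_const_mul, pow_succ',
      mul_add, mul_assoc, ← hself.tsum_eq, ← hprev.tsum_eq] at *
    rw [(hself.summable.mul_left (-lam)).tsum_add (hprev.summable.mul_left (-lam)),
      tsum_mul_left, tsum_mul_left]
    ring
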